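/- Let k be a field, let m ≥ 1, and let K = k(x₁, …, x_m) be the field of rational functions in m variables over k. Then HH^i_k(K) = Ext^i_{K ⊗_k Kᵐᵒᵖ}(K, K) = 0 for every i > m. -/

import Mathlib

open TensorProduct CategoryTheory

noncomputable section

/-- A `k`-algebra `A` is a module over its enveloping algebra `A ⊗[k] Aᵐᵒᵖ`, via
`(a ⊗ op b) • x = a * x * b`. -/
instance envModule (k A : Type) [Field k] [Ring A] [Algebra k A] :
    Module (A ⊗[k] Aᵐᵒᵖ) A := TensorProduct.Algebra.module

/-- Hochschild cohomology `HH^n_k(A) := Ext^n_{A ⊗[k] Aᵐᵒᵖ}(A, A)`, computed in the category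
of modules over the enveloping algebra `A ⊗[k] Aᵐᵒᵖ`, as a `k`-module. -/
def HH (k : Type) [Field k] (n : ℕ) (A : Type) [Ring A] [Algebra k A] : ModuleCat k :=
  ((Ext k (ModuleCat (A ⊗[k] Aᵐᵒᵖ)) n).obj
      (Opposite.op (ModuleCat.of (A ⊗[k] Aᵐᵒᵖ) A))).obj (ModuleCat.of (A ⊗[k] Aᵐᵒᵖ) A)

open RingTheory.Sequence Pointwise

/-- The derived-functor `Ext` vanishes in degree `n ≥ 1` when the first argument has projective
dimension less than `n`. -/
theorem isZero_Ext_of_hasProjectiveDimensionLT {R : Type*} [Ring R] {C : Type*} [Category* C]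
    [Abelian C] [Linear R C] [EnoughProjectives C] (X Y : C) (n : ℕ)
    [HasProjectiveDimensionLT X (n + 1)] :
    Limits.IsZero (((Ext R C (n + 1)).obj (Opposite.op X)).obj Y) := by
  let P := projectiveResolution X
  refine Limits.IsZero.of_iso ?_ (P.isoExt (n + 1) Y)
  rw [← HomologicalComplex.exactAt_iff_isZero_homology,
    HomologicalComplex.exactAt_iff' _ n (n + 1) (n + 2) (by simp) (by simp),
    ShortComplex.moduleCat_exact_iff]
  intro (f : P.complex.X (n + 1) ⟶ Y) (hf : P.complex.d (n + 2) (n + 1) ≫ f = 0)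
  let : HasExt C := HasExt.standard C
  exact (P.extMk_eq_zero_iff f (n + 2) rfl hf n rfl).mp
    (Abelian.Ext.eq_zero_of_hasProjectiveDimensionLT _ (n + 1) le_rfl)

/-- Passing to the quotient by a weakly regular sequence raises the projective dimension by at most
the length of the sequence. -/
theorem hasProjectiveDimensionLE_quotient_of_isWeaklyRegular {R : Type} [CommRing R]
    (rs : List R) (n : ℕ) (M : ModuleCat.{0} R) [HasProjectiveDimensionLE M n]
    (hrs : IsWeaklyRegular M rs) :
    HasProjectiveDimensionLE
      (ModuleCat.of R (M ⧸ (Ideal.ofList rs • ⊤ : Submodule R M))) (n + rs.length) := by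
  induction rs generalizing n M with
  | nil =>
    exact ModuleCat.hasProjectiveDimensionLE_of_linearEquiv (M := M)
      (Submodule.quotEquivOfEqBot _ (by simp)).symm n
  | cons r rs ih =>
    rw [isWeaklyRegular_cons_iff] at hrs
    have hq : HasProjectiveDimensionLE (ModuleCat.of R (QuotSMulTop r M)) (n + 1) :=
      hrs.1.smulShortComplex_shortExact.hasProjectiveDimensionLT_X₃ (n + 1) ‹_›
        (hasProjectiveDimensionLT_of_ge M (n + 1) (n + 2) (by lia))
    have := ih (n + 1) (ModuleCat.of R (QuotSMulTop r M)) hrs.2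
    rw [List.length_cons, add_comm rs.length, ← add_assoc]
    exact ModuleCat.hasProjectiveDimensionLE_of_linearEquiv
      (M := ModuleCat.of R (QuotSMulTop r M ⧸ (Ideal.ofList rs • ⊤ : Submodule R _)))
      (Submodule.quotOfListConsSMulTopEquivQuotSMulTopInner M r rs).symm (n + 1 + rs.length)

/-- If `rs` is weakly regular on `R`, then `X - C a` followed by the constants `rs` is weakly
regular on `R[X]`. -/
theorem Polynomial.isWeaklyRegular_X_sub_C_cons {R : Type*} [CommRing R] (a : R) {rs : List R}
    (hrs : IsWeaklyRegular R rs) :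
    IsWeaklyRegular (Polynomial R) ((X - C a) :: rs.map (C : R →+* Polynomial R)) := by
  refine .cons ((isSMulRegular_iff_right_eq_zero_of_smul).mpr fun p hp ↦
    (monic_X_sub_C a).mul_right_eq_zero_iff.mp hp) ?_
  let e : QuotSMulTop (X - C a) (Polynomial R) ≃+ R :=
    (QuotientAddGroup.quotientAddEquivOfEq (by
      rw [← Ideal.submodule_span_eq, ← Submodule.ideal_span_singleton_smul]
      simp)).trans (quotientSpanXSubCAlgEquiv a).toAddEquiv
  refine (AddEquiv.isWeaklyRegular_congr (e := e) ?_).mpr hrs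
  rw [List.forall₂_map_left_iff, List.forall₂_same]
  intro r _ x
  obtain ⟨p, rfl⟩ := Submodule.mkQ_surjective _ x
  change (C r * p).eval a = r * p.eval a
  simp

/-- Translated coordinates form a weakly regular sequence in a polynomial ring. -/
theorem MvPolynomial.isWeaklyRegular_X_sub_C {R : Type*} [CommRing R] (m : ℕ) (a : Fin m → R) :
    IsWeaklyRegular (MvPolynomial (Fin m) R) (List.ofFn fun i ↦ X i - C (a i)) := by
  induction m with
  | zero => simp
  | succ m ih =>
    have h := Polynomial.isWeaklyRegular_X_sub_C_cons (C (a 0)) (ih fun i ↦ a i.succ)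
    refine (AddEquiv.isWeaklyRegular_congr (e := (finSuccEquiv R m).toAddEquiv) ?_).mpr h
    have fsc (r : R) : finSuccEquiv R m (C r) = Polynomial.C (C r) :=
      (finSuccEquiv R m).commutes r
    rw [List.ofFn_succ, List.map_ofFn]
    refine .cons (fun x ↦ by simp [finSuccEquiv_X_zero, fsc]) ?_
    rw [List.forall₂_iff_get]
    refine ⟨by simp, fun i h₁ h₂ x ↦ ?_⟩
    simp [finSuccEquiv_X_succ, -Fin.succ_mk, fsc]

section Localization

variable (k : Type) [Field k] (m : ℕ) (K : Type) [CommRing K] [Algebra k K]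
  [Algebra (MvPolynomial (Fin m) k) K] [IsScalarTower k (MvPolynomial (Fin m) k) K]

/-- The elements `1 ⊗ xᵢ - xᵢ ⊗ 1` of the enveloping algebra. -/
def envDiffs : List (K ⊗[k] Kᵐᵒᵖ) :=
  List.ofFn fun i : Fin m ↦
    1 ⊗ₜ MulOpposite.op (algebraMap (MvPolynomial (Fin m) k) K (.X i)) -
      algebraMap (MvPolynomial (Fin m) k) K (.X i) ⊗ₜ 1

theorem isWeaklyRegular_envDiffs (T : Submonoid (MvPolynomial (Fin m) k)) [IsLocalization T K] :
    IsWeaklyRegular (K ⊗[k] Kᵐᵒᵖ) (envDiffs k m K) := by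
  let f : MvPolynomial (Fin m) k →ₐ[k] Kᵐᵒᵖ :=
    (AlgEquiv.toOpposite k K : K →ₐ[k] Kᵐᵒᵖ).comp
      (IsScalarTower.toAlgHom k (MvPolynomial (Fin m) k) K)
  have hf : f.Flat := by
    refine RingHom.Flat.comp (f := algebraMap (MvPolynomial (Fin m) k) K)
      (g := ((AlgEquiv.toOpposite k K : K →ₐ[k] Kᵐᵒᵖ) : K →+* Kᵐᵒᵖ))
      (RingHom.flat_algebraMap_iff.mpr (IsLocalization.flat K T))
      (.of_bijective (AlgEquiv.toOpposite k K).bijective)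
  let g : MvPolynomial (Fin m) K →+* K ⊗[k] Kᵐᵒᵖ :=
    RingHom.comp (Algebra.TensorProduct.lTensor (S := k) K f).toRingHom
      (MvPolynomial.algebraTensorAlgEquiv k K (σ := Fin m)).symm.toRingEquiv.toRingHom
  have hg : g.Flat := .comp
    (.of_bijective (MvPolynomial.algebraTensorAlgEquiv k K (σ := Fin m)).symm.bijective)
    (RingHom.Flat.lTensor K hf)
  have hC (a : K) : (MvPolynomial.algebraTensorAlgEquiv k K (σ := Fin m)).symm (.C a) = a ⊗ₜ 1 :=
    AlgEquiv.commutes _ a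
  algebraize [g]
  have h := (MvPolynomial.isWeaklyRegular_X_sub_C m fun i ↦
    algebraMap (MvPolynomial (Fin m) k) K (.X i)).of_flat (S := K ⊗[k] Kᵐᵒᵖ)
  suffices envDiffs k m K = _ from this ▸ h
  rw [List.map_ofFn, envDiffs]
  congr 1
  ext i
  simp [RingHom.algebraMap_toAlgebra, g, f, hC]

theorem one_tmul_op_sub_mem (T : Submonoid (MvPolynomial (Fin m) k)) [IsLocalization T K]
    (b : K) :
    (1 ⊗ₜ MulOpposite.op b - b ⊗ₜ 1 : K ⊗[k] Kᵐᵒᵖ) ∈ Ideal.ofList (envDiffs k m K) := by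
  rw [← Ideal.Quotient.mk_eq_mk_iff_sub_mem]
  let p := Ideal.Quotient.mkₐ k (Ideal.ofList (envDiffs k m K))
  let f : K →ₐ[k] _ := p.comp ((Algebra.TensorProduct.includeRight : Kᵐᵒᵖ →ₐ[k] K ⊗[k] Kᵐᵒᵖ).comp
    (AlgEquiv.toOpposite k K : K →ₐ[k] Kᵐᵒᵖ))
  let g : K →ₐ[k] _ := p.comp (Algebra.TensorProduct.includeLeft : K →ₐ[k] K ⊗[k] Kᵐᵒᵖ)
  suffices h : f = g from DFunLike.congr_fun h b
  refine IsLocalization.algHom_ext T ?_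
  refine MvPolynomial.algHom_ext fun i ↦ ?_
  exact Ideal.Quotient.mk_eq_mk_iff_sub_mem _ _ |>.mpr
    (Ideal.subset_span (List.mem_ofFn.mpr ⟨i, rfl⟩))

theorem env_smul_def (a b x : K) : (a ⊗ₜ MulOpposite.op b : K ⊗[k] Kᵐᵒᵖ) • x = a * x * b := by
  simp [TensorProduct.Algebra.smul_def, mul_assoc]

theorem ker_toSpanSingleton_one (T : Submonoid (MvPolynomial (Fin m) k)) [IsLocalization T K] :
    LinearMap.ker (LinearMap.toSpanSingleton (K ⊗[k] Kᵐᵒᵖ) K 1) =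
      Ideal.ofList (envDiffs k m K) := by
  apply le_antisymm
  · have key (z : K ⊗[k] Kᵐᵒᵖ) :
        z - (z • (1 : K)) ⊗ₜ 1 ∈ Ideal.ofList (envDiffs k m K) := by
      induction z with
      | zero =>
        have h : (0 : K ⊗[k] Kᵐᵒᵖ) • (1 : K) = 0 := (envModule k K).zero_smul 1
        rw [h, zero_tmul, sub_zero]
        exact zero_mem _
      | add x y hx hy =>
        rw [add_smul, add_tmul, add_sub_add_comm]
        exact add_mem hx hy
      | tmul a b =>
        induction b using MulOpposite.rec' with | h b =>
        convert Ideal.mul_mem_left _ (a ⊗ₜ 1) (one_tmul_op_sub_mem k m K T b) using 1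
        simp [env_smul_def, mul_sub]
    intro z hz
    have hz : z • (1 : K) = 0 := hz
    simpa [hz] using key z
  · rw [Ideal.ofList, Ideal.span_le]
    intro z hz
    obtain ⟨i, rfl⟩ := List.mem_ofFn.mp hz
    simp [sub_smul, env_smul_def, ← MulOpposite.op_one]

/-- A localization of `k[x₁, …, xₘ]` has projective dimension at most `m` over its enveloping
algebra. -/
theorem hasProjectiveDimensionLE_env (T : Submonoid (MvPolynomial (Fin m) k)) [IsLocalization T K] :
    HasProjectiveDimensionLE (ModuleCat.of (K ⊗[k] Kᵐᵒᵖ) K) m := by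
  have h := hasProjectiveDimensionLE_quotient_of_isWeaklyRegular (envDiffs k m K) 0
    (ModuleCat.of _ (K ⊗[k] Kᵐᵒᵖ)) (isWeaklyRegular_envDiffs k m K T)
  have hlen : 0 + (envDiffs k m K).length = m := by simp [envDiffs]
  rw [hlen] at h
  have hs : Function.Surjective (LinearMap.toSpanSingleton (K ⊗[k] Kᵐᵒᵖ) K 1) := fun a ↦
    ⟨a ⊗ₜ 1, by simp [env_smul_def, ← MulOpposite.op_one]⟩
  refine ModuleCat.hasProjectiveDimensionLE_of_linearEquiv
    (M := ModuleCat.of _ (K ⊗[k] Kᵐᵒᵖ ⧸ (Ideal.ofList (envDiffs k m K) •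
      (⊤ : Submodule (K ⊗[k] Kᵐᵒᵖ) (K ⊗[k] Kᵐᵒᵖ)))))
    ((Submodule.quotEquivOfEq _ _ ?_).trans (LinearMap.quotKerEquivOfSurjective _ hs)) m
  rw [ker_toSpanSingleton_one k m K T]
  simp

end Localization

/-- For a field `k`, `m ≥ 1` and the rational function field
`K = k(x₁,…,x_m)`, one has `HH^i_k(K) = Ext^i_{K ⊗[k] Kᵐᵒᵖ}(K, K) = 0` for all `i > m`. -/
theorem statement15 (k : Type) [Field k] (m : ℕ) (hm : 1 ≤ m) (i : ℕ) (hi : m < i) :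
    Subsingleton (HH k i (FractionRing (MvPolynomial (Fin m) k)) : Type) := by
  obtain ⟨n, rfl⟩ : ∃ n, i = n + 1 := ⟨i - 1, by lia⟩
  let K := FractionRing (MvPolynomial (Fin m) k)
  have := hasProjectiveDimensionLE_env k m K (nonZeroDivisors (MvPolynomial (Fin m) k))
  have : HasProjectiveDimensionLT (ModuleCat.of (K ⊗[k] Kᵐᵒᵖ) K) (n + 1) :=
    hasProjectiveDimensionLT_of_ge _ (m + 1) (n + 1) (by lia)
  exact ModuleCat.subsingleton_of_isZero (isZero_Ext_of_hasProjectiveDimensionLT _ _ n)
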